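/- If S is a locally compact regular formal topology, then the canonical map ε_P : Patch(S) → S is an isomorphism of formal topologies. -/

import Mathlib

noncomputable section
open Classical

universe u v

namespace FTP

/-! ### Basic covers -/

/-- `U ◁ V` : every element of `U` is covered by `V`. -/
def covS {S : Type*} (cov : S → Set S → Prop) (U V : Set S) : Prop :=
  ∀ a ∈ U, cov a V

/-- A basic cover: reflexivity and transitivity. -/
def IsBasicCover {S : Type*} (cov : S → Set S → Prop) : Prop :=
  (∀ (a : S) (U : Set S), a ∈ U → cov a U) ∧
  (∀ (a : S) (U V : Set S), cov a U → covS cov U V → cov a V)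

/-- the way-below relation `a ≪ b`. -/
def wb {S : Type*} (cov : S → Set S → Prop) (a b : S) : Prop :=
  ∀ U : Set S, cov b U → ∃ U₀ : Finset S, ↑U₀ ⊆ U ∧ cov a ↑U₀

/-- the way-below relation between subsets `U ≪ V`. -/
def wbS {S : Type*} (cov : S → Set S → Prop) (U V : Set S) : Prop :=
  ∀ W : Set S, covS cov V W → ∃ W₀ : Finset S, ↑W₀ ⊆ W ∧ covS cov U ↑W₀

/-- A continuous basic cover, with the witnessing function `w`. -/
def IsContinuous {S : Type*} (cov : S → Set S → Prop) (w : S → Set S) : Prop :=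
  (∀ a : S, ∀ b ∈ w a, wb cov b a) ∧ (∀ a : S, cov a (w a))

/-- splitting subsets. -/
def Splitting {S : Type*} (cov : S → Set S → Prop) (V : Set S) : Prop :=
  ∀ (a : S) (U : Set S), a ∈ V → cov a U → (V ∩ U).Nonempty

/-- located subsets. -/
def Located {S : Type*} (cov : S → Set S → Prop) (V : Set S) : Prop :=
  Splitting cov V ∧ ∀ a b : S, wb cov a b → a ∉ V ∨ b ∈ V

/-- inverse image of a relation. -/
def rinv {α β : Type*} (r : α → β → Prop) (U : Set β) : Set α :=
  {x | ∃ a ∈ U, r x a}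

/-- basic cover maps. -/
def IsBCM {α β : Type*} (cov : α → Set α → Prop) (cov' : β → Set β → Prop)
    (r : α → β → Prop) : Prop :=
  ∀ (a : β) (U : Set β), cov' a U → covS cov (rinv r {a}) (rinv r U)

/-- perfect maps. -/
def IsPerfect {α β : Type*} (cov : α → Set α → Prop) (cov' : β → Set β → Prop)
    (r : α → β → Prop) : Prop :=
  ∀ a b : β, wb cov' a b → wbS cov (rinv r {a}) (rinv r {b})

/-- the terminal basic cover `1 = ({∗}, ∈)`. -/
def unitCov : Unit → Set Unit → Prop := fun x U => x ∈ U

/-! ### Formal topologies -/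

/-- `U ↓ V` with respect to a preorder `le`. -/
def down {S : Type*} (le : S → S → Prop) (U V : Set S) : Set S :=
  {c | ∃ a ∈ U, ∃ b ∈ V, le c a ∧ le c b}

/-- A formal topology: a basic cover together with a compatible preorder. -/
def IsFormalTopology {S : Type*} (cov : S → Set S → Prop) (le : S → S → Prop) : Prop :=
  IsBasicCover cov ∧ Reflexive le ∧ Transitive le ∧
  (∀ a b : S, le a b → cov a {b}) ∧
  (∀ (a : S) (U V : Set S), cov a U → cov a V → cov a (down le U V))

/-- formal topology maps. -/
def IsFTM {α β : Type*} (cov : α → Set α → Prop) (le : α → α → Prop)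
    (cov' : β → Set β → Prop) (le' : β → β → Prop) (r : α → β → Prop) : Prop :=
  IsBCM cov cov' r ∧
  covS cov Set.univ (rinv r Set.univ) ∧
  ∀ a b : β, covS cov (down le (rinv r {a}) (rinv r {b})) (rinv r (down le' {a} {b}))

/-- the order on maps. -/
def MapLE {α β : Type*} (cov : α → Set α → Prop) (r s : α → β → Prop) : Prop :=
  ∀ a : β, covS cov (rinv r {a}) (rinv s {a})

/-- equality of maps. -/
def MapEq {α β : Type*} (cov : α → Set α → Prop) (r s : α → β → Prop) : Prop :=
  MapLE cov r s ∧ MapLE cov s r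

/-- composition of relational maps (`comp s r = s ∘ r`). -/
def comp {α β γ : Type*} (s : β → γ → Prop) (r : α → β → Prop) : α → γ → Prop :=
  fun x c => ∃ b, r x b ∧ s b c

/-- `b* = {c | c ↓ b ◁ ∅}`. -/
def star {S : Type*} (cov : S → Set S → Prop) (le : S → S → Prop) (b : S) : Set S :=
  {c | covS cov (down le {c} {b}) ∅}

/-- `b ⋘ a` iff `S ◁ b* ∪ {a}`. -/
def wc {S : Type*} (cov : S → Set S → Prop) (le : S → S → Prop) (b a : S) : Prop :=
  covS cov Set.univ (star cov le b ∪ {a})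

/-- regular formal topologies. -/
def Regular {S : Type*} (cov : S → Set S → Prop) (le : S → S → Prop) : Prop :=
  ∀ a : S, cov a {b | wc cov le b a}

/-- compactness: `S ≪ S`. -/
def Compact {S : Type*} (cov : S → Set S → Prop) : Prop :=
  wbS cov Set.univ Set.univ

/-- stability: `a ≪ a'` and `b ≪ b'` imply `a↓b ≪ a'↓b'`. -/
def Stable {S : Type*} (cov : S → Set S → Prop) (le : S → S → Prop) : Prop :=
  ∀ a a' b b' : S, wb cov a a' → wb cov b b' →
    wbS cov (down le {a} {b}) (down le {a'} {b'})

/-- isomorphism of formal topologies. -/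
def IsIso {α β : Type*} (cov : α → Set α → Prop) (le : α → α → Prop)
    (cov' : β → Set β → Prop) (le' : β → β → Prop) : Prop :=
  ∃ (r : α → β → Prop) (s : β → α → Prop),
    IsFTM cov le cov' le' r ∧ IsFTM cov' le' cov le s ∧
    MapEq cov (comp s r) (fun a b => a = b) ∧
    MapEq cov' (comp r s) (fun a b => a = b)

/-! ### Geometric theories and the covers they present -/

/-- the preorder `A ≤ B ↔ B ⊆ A` on finite sets of generators. -/
def supord {P : Type*} : Finset P → Finset P → Prop := fun A B => B ⊆ A

/-- The cover on `Finset P` inductively generated by a geometric theory `T`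
(an axiom `T A 𝒞` means `⋀A ⊢ ⋁_{B ∈ 𝒞} ⋀B`). -/
inductive GCov {P : Type*} (T : Finset P → Set (Finset P) → Prop) :
    Finset P → Set (Finset P) → Prop where
  | refl {A : Finset P} {𝒰 : Set (Finset P)} : A ∈ 𝒰 → GCov T A 𝒰
  | le {A B : Finset P} {𝒰 : Set (Finset P)} : B ⊆ A → GCov T B 𝒰 → GCov T A 𝒰
  | ax {A : Finset P} {𝒞 𝒰 : Set (Finset P)} (C : Finset P) :
      T A 𝒞 → (∀ B ∈ 𝒞, GCov T (C ∪ B) 𝒰) → GCov T (C ∪ A) 𝒰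

theorem GCov_trans {P : Type*} {T : Finset P → Set (Finset P) → Prop}
    {A : Finset P} {𝒰 𝒱 : Set (Finset P)}
    (h : GCov T A 𝒰) (h' : ∀ B ∈ 𝒰, GCov T B 𝒱) : GCov T A 𝒱 := by
  induction h with
  | refl hA => exact h' _ hA
  | le hBA _ ih => exact GCov.le hBA (ih h')
  | ax C hT _ ih => exact GCov.ax C hT (fun B hB => ih B hB h')

theorem GCov_isBasicCover {P : Type*} (T : Finset P → Set (Finset P) → Prop) :
    IsBasicCover (GCov T) :=
  ⟨fun _ _ h => GCov.refl h, fun _ _ _ h h' => GCov_trans h h'⟩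

/-! ### The patch, Lawson and lower powerlocale theories -/

/-- generators of the patch/Lawson theories : `r a` and `l A`. -/
inductive PatchGen (S : Type u) : Type u where
  | r : S → PatchGen S
  | l : Finset S → PatchGen S

/-- The geometric theory `T_P` presenting the patch of a stably locally compact
formal topology. -/
inductive PatchThy {S : Type*} (cov : S → Set S → Prop) (le : S → S → Prop) :
    Finset (PatchGen S) → Set (Finset (PatchGen S)) → Prop where
  | R1 : PatchThy cov le ∅ {B | ∃ a : S, B = {PatchGen.r a}}
  | R2 (a b : S) :
      PatchThy cov le {PatchGen.r a, PatchGen.r b}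
        {B | ∃ c ∈ down le {a} {b}, B = {PatchGen.r c}}
  | R3 (a : S) (A : Finset S) :
      cov a ↑A → PatchThy cov le {PatchGen.r a} {B | ∃ b ∈ A, B = {PatchGen.r b}}
  | R4 (a : S) :
      PatchThy cov le {PatchGen.r a} {B | ∃ b : S, wb cov b a ∧ B = {PatchGen.r b}}
  | L1 : PatchThy cov le ∅ {({PatchGen.l ∅} : Finset (PatchGen S))}
  | L2 (A B : Finset S) :
      covS cov ↑A ↑B →
      PatchThy cov le {PatchGen.l B} {({PatchGen.l A} : Finset (PatchGen S))}
  | L3 (A B : Finset S) :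
      PatchThy cov le {PatchGen.l A, PatchGen.l B}
        {D | ∃ C : Finset S, wbS cov ↑A ↑C ∧ wbS cov ↑B ↑C ∧ D = {PatchGen.l C}}
  | Loc (a b : S) :
      wb cov a b →
      PatchThy cov le ∅
        {({PatchGen.l {a}} : Finset (PatchGen S)), ({PatchGen.r b} : Finset (PatchGen S))}
  | D (a : S) :
      PatchThy cov le {PatchGen.l {a}, PatchGen.r a} (∅ : Set (Finset (PatchGen S)))

/-- the cover of `Patch(S)`. -/
def patchCov {S : Type*} (cov : S → Set S → Prop) (le : S → S → Prop) :
    Finset (PatchGen S) → Set (Finset (PatchGen S)) → Prop :=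
  GCov (PatchThy cov le)

/-- the counit `ε_P : Patch(S) → S`. -/
def epsP {S : Type*} (cov : S → Set S → Prop) (le : S → S → Prop) :
    Finset (PatchGen S) → S → Prop :=
  fun 𝔄 a => patchCov cov le 𝔄 {({PatchGen.r a} : Finset (PatchGen S))}

/-- The geometric theory `T_L` presenting the Lawson topology of a continuous
basic cover (the axioms of `T_P` without (R1), (R2)). -/
inductive LawsonThy {S : Type*} (cov : S → Set S → Prop) :
    Finset (PatchGen S) → Set (Finset (PatchGen S)) → Prop where
  | R3 (a : S) (A : Finset S) :
      cov a ↑A → LawsonThy cov {PatchGen.r a} {B | ∃ b ∈ A, B = {PatchGen.r b}}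
  | R4 (a : S) :
      LawsonThy cov {PatchGen.r a} {B | ∃ b : S, wb cov b a ∧ B = {PatchGen.r b}}
  | L1 : LawsonThy cov ∅ {({PatchGen.l ∅} : Finset (PatchGen S))}
  | L2 (A B : Finset S) :
      covS cov ↑A ↑B →
      LawsonThy cov {PatchGen.l B} {({PatchGen.l A} : Finset (PatchGen S))}
  | L3 (A B : Finset S) :
      LawsonThy cov {PatchGen.l A, PatchGen.l B}
        {D | ∃ C : Finset S, wbS cov ↑A ↑C ∧ wbS cov ↑B ↑C ∧ D = {PatchGen.l C}}
  | Loc (a b : S) :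
      wb cov a b →
      LawsonThy cov ∅
        {({PatchGen.l {a}} : Finset (PatchGen S)), ({PatchGen.r b} : Finset (PatchGen S))}
  | D (a : S) :
      LawsonThy cov {PatchGen.l {a}, PatchGen.r a} (∅ : Set (Finset (PatchGen S)))

/-- the cover of the Lawson topology `L(S)`. -/
def lawsonCov {S : Type*} (cov : S → Set S → Prop) :
    Finset (PatchGen S) → Set (Finset (PatchGen S)) → Prop :=
  GCov (LawsonThy cov)

/-- the counit `ε_L : L(S) → S`. -/
def epsL {S : Type*} (cov : S → Set S → Prop) : Finset (PatchGen S) → S → Prop :=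
  fun 𝔄 a => lawsonCov cov 𝔄 {({PatchGen.r a} : Finset (PatchGen S))}

/-- The theory presenting the lower powerlocale of a continuous basic cover:
generators `a ∈ S`, axioms (R3) and (R4). -/
inductive LowerThy {S : Type*} (cov : S → Set S → Prop) :
    Finset S → Set (Finset S) → Prop where
  | R3 (a : S) (A : Finset S) :
      cov a ↑A → LowerThy cov {a} {B | ∃ b ∈ A, B = ({b} : Finset S)}
  | R4 (a : S) :
      LowerThy cov {a} {B | ∃ b : S, wb cov b a ∧ B = ({b} : Finset S)}

/-- the cover of the lower powerlocale `Lower(S)`. -/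
def lowerCov {S : Type*} (cov : S → Set S → Prop) :
    Finset S → Set (Finset S) → Prop :=
  GCov (LowerThy cov)

/-- the counit `σ_L : Lower(S) → S`. -/
def sigmaL {S : Type*} (cov : S → Set S → Prop) : Finset S → S → Prop :=
  fun A a => lowerCov cov A ({({a} : Finset S)} : Set (Finset S))

/-! ### de Groot duals -/

/-- `↟A = {B ∈ Fin S | A ≪ B}`. -/
def upF {S : Type*} (cov : S → Set S → Prop) (A : Finset S) : Set (Finset S) :=
  {B | wbS cov ↑A ↑B}

/-- the finite join `⋁^F {↟A | A ∈ 𝒜}` of Scott open filters. -/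
def finJoin {S : Type*} (cov : S → Set S → Prop) (le : S → S → Prop)
    (𝒜 : Finset (Finset S)) : Set (Finset S) :=
  if 𝒜 = ∅ then {B | covS cov Set.univ ↑B}
  else {B | ∃ g : Finset S → Finset S,
    (∀ A ∈ 𝒜, wbS cov ↑A ↑(g A)) ∧
    wbS cov {c | ∀ A ∈ 𝒜, ∃ b ∈ g A, le c b} ↑B}

/-- The cover `◁^D` of the de Groot dual `S^D`, inductively generated on
`(Fin S, ⊇)` by the axioms (D3) `A ◁ ↟A` and (D4). -/
inductive DCov {S : Type*} (cov : S → Set S → Prop) (le : S → S → Prop) :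
    Finset S → Set (Finset S) → Prop where
  | refl {A : Finset S} {𝒰 : Set (Finset S)} : A ∈ 𝒰 → DCov cov le A 𝒰
  | le {A B : Finset S} {𝒰 : Set (Finset S)} :
      B ⊆ A → DCov cov le B 𝒰 → DCov cov le A 𝒰
  | d3 {A A' : Finset S} {𝒰 : Set (Finset S)} :
      A ⊆ A' →
      (∀ C : Finset S, A' ⊆ C → (∃ B : Finset S, wbS cov ↑A ↑B ∧ B ⊆ C) →
        DCov cov le C 𝒰) →
      DCov cov le A' 𝒰
  | d4 {A A' : Finset S} {𝒜 : Finset (Finset S)} {𝒰 : Set (Finset S)} :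
      A ⊆ A' → upF cov A ⊆ finJoin cov le 𝒜 →
      (∀ C : Finset S, A' ⊆ C → (∃ B ∈ 𝒜, B ⊆ C) → DCov cov le C 𝒰) →
      DCov cov le A' 𝒰

/-- the cover of the Scott topology `Σ(S)` on `(Fin S, ⊇)`. -/
def scottCov {S : Type*} (cov : S → Set S → Prop) :
    Finset S → Set (Finset S) → Prop :=
  fun A 𝒰 => upF cov A ⊆ ⋃ B ∈ 𝒰, upF cov B

/-- a filter (with respect to `◁`) of basic opens, given by a set of finite subsets. -/
def IsCovFilter {S : Type*} (cov : S → Set S → Prop) (le : S → S → Prop)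
    (𝒱 : Set (Finset S)) : Prop :=
  𝒱.Nonempty ∧
  (∀ A ∈ 𝒱, ∀ B : Finset S, covS cov ↑A ↑B → B ∈ 𝒱) ∧
  (∀ A ∈ 𝒱, ∀ B ∈ 𝒱, ∃ C ∈ 𝒱, covS cov ↑C (down le ↑A ↑B))

/-- The geometric theory `T^d` presenting the de Groot dual `S^d`:
generators `l A` (identified with `A : Finset S`), axioms (L1)–(L3) and (D4). -/
inductive DGThy {S : Type*} (cov : S → Set S → Prop) (le : S → S → Prop) :
    Finset (Finset S) → Set (Finset (Finset S)) → Prop where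
  | L1 : DGThy cov le ∅ {({(∅ : Finset S)} : Finset (Finset S))}
  | L2 (A B : Finset S) :
      covS cov ↑A ↑B → DGThy cov le {B} {({A} : Finset (Finset S))}
  | L3 (A B : Finset S) :
      DGThy cov le {A, B}
        {D | ∃ C : Finset S, wbS cov ↑A ↑C ∧ wbS cov ↑B ↑C ∧ D = ({C} : Finset (Finset S))}
  | D4 (A : Finset S) (𝒜 : Finset (Finset S)) :
      upF cov A ⊆ finJoin cov le 𝒜 →
      DGThy cov le {A} {D | ∃ B ∈ 𝒜, D = ({B} : Finset (Finset S))}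

/-! ### Spectral formal topologies -/

/-- spectral formal topologies: a compatible meet-semilattice structure on the
base, with every basic element way-below itself. -/
def IsSpectral {S : Type*} (cov : S → Set S → Prop) (le : S → S → Prop)
    (one : S) (meet : S → S → S) : Prop :=
  (∀ a : S, cov a {one}) ∧
  (∀ a b : S, cov (meet a b) (down le {a} {b})) ∧
  (∀ a b : S, ∀ c ∈ down le {a} {b}, cov c {meet a b}) ∧
  (∀ a : S, wb cov a a)

/-! ### Subtopologies -/

/-- the property of being a formal-topology cover compatible with `le`. -/
def IsFTCover {S : Type*} (cov : S → Set S → Prop) (le : S → S → Prop) : Prop :=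
  IsBasicCover cov ∧ (∀ a b : S, le a b → cov a {b}) ∧
  (∀ (a : S) (U V : Set S), cov a U → cov a V → cov a (down le U V))

/-- The meet (in `SubTop(S)`) of a family of subtopology covers: the least
formal-topology cover containing all of them. -/
def covMeet {S : Type*} {ι : Sort*} (le : S → S → Prop)
    (F : ι → (S → Set S → Prop)) : S → Set S → Prop :=
  fun a U => ∀ c : S → Set S → Prop,
    IsFTCover c le → (∀ i : ι, ∀ (a' : S) (U' : Set S), F i a' U' → c a' U') → c a U

/-- the closed subtopology `C_a` determined by `{a}`. -/
def closedCov {S : Type*} (cov : S → Set S → Prop) (a : S) : S → Set S → Prop :=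
  fun c V => cov c ({a} ∪ V)

/-- the open subtopology `S_B` determined by a finite `B`. -/
def openCov {S : Type*} (cov : S → Set S → Prop) (le : S → S → Prop)
    (B : Finset S) : S → Set S → Prop :=
  fun c V => covS cov (down le {c} ↑B) V

/-- `K_A = ⋀_{A ≪ B} S_B`. -/
def KCov {S : Type*} (cov : S → Set S → Prop) (le : S → S → Prop) (A : Finset S) :
    S → Set S → Prop :=
  covMeet le (fun B : {B : Finset S // wbS cov ↑A ↑B} => openCov cov le B.1)

/-- `C_a ∨ K_A` (the join of subtopologies is the intersection of covers). -/
def CKCov {S : Type*} (cov : S → Set S → Prop) (le : S → S → Prop)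
    (a : S) (A : Finset S) : S → Set S → Prop :=
  fun c V => closedCov cov a c V ∧ KCov cov le A c V

/-- perfect subtopologies. -/
def IsPerfectSub {S : Type*} (cov : S → Set S → Prop) (le : S → S → Prop)
    (cov' : S → Set S → Prop) : Prop :=
  IsFTCover cov' le ∧ (∀ (a : S) (U : Set S), cov a U → cov' a U) ∧
  (∀ a b : S, wb cov a b → wb cov' a b)

/-- the order of `PSub(S)`: `(a,A) ≤ (b,B)` iff `C_b ∨ K_B ⊑ C_a ∨ K_A`. -/
def PSubLe {S : Type*} (cov : S → Set S → Prop) (le : S → S → Prop) :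
    S × Finset S → S × Finset S → Prop :=
  fun p q => ∀ (c : S) (V : Set S), CKCov cov le p.1 p.2 c V → CKCov cov le q.1 q.2 c V

/-- the cover of `PSub(S)`: `(a,A) ◁ U` iff `⋀{C_b ∨ K_B | (b,B) ∈ U} ⊑ C_a ∨ K_A`. -/
def covPSub {S : Type*} (cov : S → Set S → Prop) (le : S → S → Prop) :
    S × Finset S → Set (S × Finset S) → Prop :=
  fun p U => ∀ (c : S) (V : Set S), CKCov cov le p.1 p.2 c V →
    covMeet le (fun q : U => CKCov cov le q.1.1 q.1.2) c V

/-- the map `r : PSub(S) → Patch(S)` on generators. -/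
def rGenPS {S : Type*} (cov : S → Set S → Prop) (le : S → S → Prop)
    (p : S × Finset S) : PatchGen S → Prop
  | PatchGen.r b => covPSub cov le p {((b, (∅ : Finset S)) : S × Finset S)}
  | PatchGen.l B => covPSub cov le p {q : S × Finset S | q.2 = B}

/-- the map `r : PSub(S) → Patch(S)`, extended along the presentation. -/
def rPS {S : Type*} (cov : S → Set S → Prop) (le : S → S → Prop) :
    S × Finset S → Finset (PatchGen S) → Prop :=
  fun p 𝔅 => ∀ g ∈ 𝔅, covPSub cov le p (rinv (fun q g' => rGenPS cov le q g') {g})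

/-- the map `s : Patch(S) → PSub(S)`. -/
def sPS {S : Type*} (cov : S → Set S → Prop) (le : S → S → Prop) :
    Finset (PatchGen S) → (S × Finset S) → Prop :=
  fun 𝔄 p => patchCov cov le 𝔄
    ({({PatchGen.r p.1, PatchGen.l p.2} : Finset (PatchGen S))} : Set (Finset (PatchGen S)))

/-! ### Saturated subsets, dcpos and preframes -/

/-- the saturated subsets of a basic cover. -/
abbrev SatSet {α : Type*} (cov : α → Set α → Prop) : Type _ :=
  {U : Set α // ∀ a, cov a U → a ∈ U}

/-- the join of a family of saturated subsets. -/
def satSup {α : Type*} {cov : α → Set α → Prop} (hbc : IsBasicCover cov)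
    (D : Set (SatSet cov)) : SatSet cov :=
  ⟨{a | cov a (⋃ U ∈ D, (U : Set α))}, fun a h => hbc.2 a _ _ h (fun _ hb => hb)⟩

/-- inductively generated basic covers: `BGen Ax` is the cover generated by the
axiom-set with axioms `a ◁ C` for `C ∈ Ax a`. -/
inductive BGen {S : Type*} (Ax : S → Set (Set S)) : S → Set S → Prop where
  | refl {a : S} {U : Set S} : a ∈ U → BGen Ax a U
  | infty {a : S} {U : Set S} (C : Set S) :
      C ∈ Ax a → (∀ b ∈ C, BGen Ax b U) → BGen Ax a U

theorem BGen_trans {S : Type*} {Ax : S → Set (Set S)} {a : S} {U V : Set S}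
    (h : BGen Ax a U) (h' : ∀ b ∈ U, BGen Ax b V) : BGen Ax a V := by
  induction h with
  | refl ha => exact h' _ ha
  | infty C hC _ ih => exact BGen.infty C hC (fun b hb => ih b hb h')

theorem BGen_isBasicCover {S : Type*} (Ax : S → Set (Set S)) :
    IsBasicCover (BGen Ax) :=
  ⟨fun _ _ h => BGen.refl h, fun _ _ _ h h' => BGen_trans h h'⟩

/-- the lower powerlocale theory of an inductively generated basic cover. -/
inductive LowerThyAx {S : Type*} (Ax : S → Set (Set S)) :
    Finset S → Set (Finset S) → Prop where
  | mk (a : S) (C : Set S) :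
      C ∈ Ax a → LowerThyAx Ax {a} {B | ∃ b ∈ C, B = ({b} : Finset S)}

/-- the counit `σ_L : Lower(S) → S` for an inductively generated basic cover. -/
def sigmaLAx {S : Type*} (Ax : S → Set (Set S)) : Finset S → S → Prop :=
  fun A a => GCov (LowerThyAx Ax) A ({({a} : Finset S)} : Set (Finset S))

/-- the top saturated subset of a presented topology. -/
def satTop {P : Type*} (T : Finset P → Set (Finset P) → Prop) : SatSet (GCov T) :=
  ⟨Set.univ, fun _ _ => Set.mem_univ _⟩

/-- binary meets of saturated subsets of a presented topology. -/
def satInfL {P : Type*} (T : Finset P → Set (Finset P) → Prop)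
    (U V : SatSet (GCov T)) : SatSet (GCov T) :=
  ⟨{A | GCov T A (down supord (U : Set (Finset P)) (V : Set (Finset P)))},
   fun _ h => GCov_trans h (fun _ hB => hB)⟩

/-- the suplattice homomorphism `σ_L* : Sat(S) → Sat(Lower(S))`. -/
def sigmaStar {S : Type*} (Ax : S → Set (Set S)) (U : SatSet (BGen Ax)) :
    SatSet (GCov (LowerThyAx Ax)) :=
  ⟨{A : Finset S | GCov (LowerThyAx Ax) A (rinv (sigmaLAx Ax) (U : Set S))},
   fun _ h => GCov_trans h (fun _ hB => hB)⟩

/-- a preframe structure on a partial order: finite meets and directed joins,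
with finite meets distributing over directed joins. -/
structure PreframeStr (X : Type*) [PartialOrder X] where
  top : X
  inf : X → X → X
  dSup : Set X → X
  le_top : ∀ x, x ≤ top
  inf_le_left : ∀ x y, inf x y ≤ x
  inf_le_right : ∀ x y, inf x y ≤ y
  le_inf : ∀ x y z, x ≤ y → x ≤ z → x ≤ inf y z
  le_dSup : ∀ d : Set X, d.Nonempty → DirectedOn (· ≤ ·) d → ∀ x ∈ d, x ≤ dSup d
  dSup_le : ∀ d : Set X, d.Nonempty → DirectedOn (· ≤ ·) d →
    ∀ z, (∀ x ∈ d, x ≤ z) → dSup d ≤ z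
  distrib : ∀ (x : X) (d : Set X), d.Nonempty → DirectedOn (· ≤ ·) d →
    inf x (dSup d) = dSup ((fun y => inf x y) '' d)

/-- dcpo homomorphisms out of `Sat(S)`. -/
def IsDcpoHom {α : Type*} {cov : α → Set α → Prop} (hbc : IsBasicCover cov)
    {X : Type*} [PartialOrder X] (PF : PreframeStr X) (f : SatSet cov → X) : Prop :=
  Monotone f ∧
  ∀ D : Set (SatSet cov), D.Nonempty → DirectedOn (· ≤ ·) D →
    f (satSup hbc D) = PF.dSup (f '' D)

/-- preframe homomorphisms out of the frame of a presented topology. -/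
def IsPreframeHomL {P : Type*} (T : Finset P → Set (Finset P) → Prop)
    {X : Type*} [PartialOrder X] (PF : PreframeStr X)
    (F : SatSet (GCov T) → X) : Prop :=
  Monotone F ∧ F (satTop T) = PF.top ∧
  (∀ U V, F (satInfL T U V) = PF.inf (F U) (F V)) ∧
  ∀ D : Set (SatSet (GCov T)), D.Nonempty → DirectedOn (· ≤ ·) D →
    F (satSup (GCov_isBasicCover T) D) = PF.dSup (F '' D)

/-! ### Located subsets: auxiliary notions -/

/-- the lower part `L_V` associated to a located subset `V`. -/
def LV {S : Type*} (cov : S → Set S → Prop) (V : Set S) : Set S :=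
  {a | ∃ A : Finset S, wbS cov {a} ↑A ∧ (↑A ∩ V : Set S) = ∅}

/-- cuts of a continuous basic cover. -/
def IsCut {S : Type*} (cov : S → Set S → Prop) (L U : Set S) : Prop :=
  (∀ (a : S) (A : Finset S), cov a ↑A → a ∈ U → ((↑A : Set S) ∩ U).Nonempty) ∧
  (∀ a ∈ U, ∃ b : S, wb cov b a ∧ b ∈ U) ∧
  (∀ (a : S) (A : Finset S), cov a ↑A → (↑A : Set S) ⊆ L → a ∈ L) ∧
  (∀ a ∈ L, ∃ A : Finset S, wbS cov {a} ↑A ∧ (↑A : Set S) ⊆ L) ∧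
  (∀ a b : S, wb cov a b → a ∈ L ∨ b ∈ U) ∧
  L ∩ U = ∅

end FTP

namespace FTP

section Cover

variable {S : Type*} {cov : S → Set S → Prop}

theorem IsBasicCover.mono (hb : IsBasicCover cov) {a : S} {U V : Set S}
    (h : cov a U) (hUV : U ⊆ V) : cov a V :=
  hb.2 a U V h fun _ hx => hb.1 _ _ (hUV hx)

theorem wbS.covS (hb : IsBasicCover cov) {U V : Set S} (h : wbS cov U V) : covS cov U V := by
  obtain ⟨W₀, hW, hc⟩ := h V fun a ha => hb.1 a V ha
  exact fun a ha => hb.mono (hc a ha) hW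

theorem wbS_of_covS_left (hb : IsBasicCover cov) {U V W : Set S}
    (hUV : covS cov U V) (h : wbS cov V W) : wbS cov U W := by
  intro X hX
  obtain ⟨W₀, hW, hc⟩ := h X hX
  exact ⟨W₀, hW, fun a ha => hb.2 a V _ (hUV a ha) hc⟩

theorem wbS_of_covS_right (hb : IsBasicCover cov) {U V W : Set S}
    (h : wbS cov U V) (hVW : covS cov V W) : wbS cov U W :=
  fun X hX => h X fun a ha => hb.2 a W _ (hVW a ha) hX

/-- Finitely many elements, each covered by a finite subset of `W`, are covered by a common one. -/
theorem exists_finset_covS (hb : IsBasicCover cov) {W : Set S} (F : Finset S)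
    (h : ∀ y ∈ F, ∃ W₀ : Finset S, ↑W₀ ⊆ W ∧ cov y ↑W₀) :
    ∃ W₀ : Finset S, ↑W₀ ⊆ W ∧ covS cov ↑F ↑W₀ := by
  induction F using Finset.induction_on with
  | empty => exact ⟨∅, by simp, by simp [covS]⟩
  | insert y F _ ih =>
    obtain ⟨A, hA, hyA⟩ := h y (Finset.mem_insert_self _ _)
    obtain ⟨B, hB, hFB⟩ := ih fun z hz => h z (Finset.mem_insert_of_mem hz)
    refine ⟨A ∪ B, by simp [hA, hB], fun z hz => ?_⟩
    rcases Finset.mem_insert.1 (Finset.mem_coe.1 hz) with rfl | hz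
    · exact hb.mono hyA (by simp)
    · exact hb.mono (hFB z hz) (by simp)

theorem wbS_of_forall_exists_wb (hb : IsBasicCover cov) (F : Finset S) {X : Set S}
    (h : ∀ y ∈ F, ∃ x ∈ X, wb cov y x) : wbS cov ↑F X := by
  intro W hW
  refine exists_finset_covS hb F fun y hy => ?_
  obtain ⟨x, hx, hyx⟩ := h y hy
  exact hyx W (hW x hx)

theorem wbS_union (hb : IsBasicCover cov) {A B : Finset S} {X : Set S}
    (hA : wbS cov ↑A X) (hB : wbS cov ↑B X) : wbS cov ↑(A ∪ B) X := by
  intro W hW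
  obtain ⟨A₀, hA₀, hA⟩ := hA W hW
  obtain ⟨B₀, hB₀, hB⟩ := hB W hW
  refine ⟨A₀ ∪ B₀, by simp [hA₀, hB₀], fun z hz => ?_⟩
  rcases Finset.mem_union.1 (Finset.mem_coe.1 hz) with hz | hz
  · exact hb.mono (hA z hz) (by simp)
  · exact hb.mono (hB z hz) (by simp)

theorem wbS_singleton {a b : S} (h : wb cov a b) : wbS cov {a} {b} := by
  intro W hW
  obtain ⟨W₀, h₁, h₂⟩ := h W (hW b rfl)
  exact ⟨W₀, h₁, by rintro _ rfl; exact h₂⟩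

theorem IsContinuous.exists_finset_wb (hb : IsBasicCover cov) {w : S → Set S}
    (hw : IsContinuous cov w) {B C : Set S} (h : wbS cov B C) :
    ∃ F : Finset S, covS cov B ↑F ∧ ∀ y ∈ F, ∃ c ∈ C, wb cov y c := by
  obtain ⟨F, hF, hc⟩ := h {y | ∃ c ∈ C, wb cov y c} fun c hc =>
    hb.mono (hw.2 c) fun y hy => ⟨c, hc, hw.1 c y hy⟩
  exact ⟨F, hc, fun y hy => hF hy⟩

/-- Interpolation for the way-below relation on subsets. -/
theorem IsContinuous.exists_between (hb : IsBasicCover cov) {w : S → Set S}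
    (hw : IsContinuous cov w) {B C : Set S} (h : wbS cov B C) :
    ∃ X : Finset S, wbS cov B ↑X ∧ wbS cov ↑X C := by
  obtain ⟨F, hF, hc⟩ := h {y | ∃ x, wb cov y x ∧ ∃ c ∈ C, wb cov x c} fun c hc =>
    hb.2 c (w c) _ (hw.2 c) fun x hx =>
      hb.mono (hw.2 x) fun y hy => ⟨x, hw.1 x y hy, c, hc, hw.1 c x hx⟩
  have hF : ∀ y ∈ F, ∃ x, wb cov y x ∧ ∃ c ∈ C, wb cov x c := fun y hy => hF hy
  choose! f hf using hF
  refine ⟨F.image f, wbS_of_covS_left hb hc (wbS_of_forall_exists_wb hb F fun y hy =>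
    ⟨f y, by simpa using ⟨y, hy, rfl⟩, (hf y hy).1⟩), wbS_of_forall_exists_wb hb _ ?_⟩
  intro x hx
  obtain ⟨y, hy, rfl⟩ := Finset.mem_image.1 hx
  exact (hf y hy).2

end Cover

section FormalTopology

variable {S : Type*} {cov : S → Set S → Prop} {le : S → S → Prop}

theorem IsFormalTopology.cov_down (hft : IsFormalTopology cov le) {c e : S} {A W : Set S}
    (he : e ∈ down le {c} A) (hA : covS cov A W) : cov e (down le {c} W) := by
  obtain ⟨hb, _, _, hle, hdn⟩ := hft
  obtain ⟨_, rfl, a, ha, h₁, h₂⟩ := he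
  exact hdn _ _ _ (hle _ _ h₁) (hb.2 _ _ _ (hle _ _ h₂) fun _ hx => hx ▸ hA a ha)

/-- The elements disjoint from `B`. -/
def disj (cov : S → Set S → Prop) (le : S → S → Prop) (B : Set S) : Set S :=
  {c | covS cov (down le {c} B) ∅}

theorem IsFormalTopology.disj_anti (hft : IsFormalTopology cov le) {A B : Set S}
    (h : covS cov A B) : disj cov le B ⊆ disj cov le A :=
  fun _ hc _ he => hft.1.2 _ _ _ (hft.cov_down he h) hc

theorem IsFormalTopology.disj_of_le (hft : IsFormalTopology cov le) {B : Set S} {c d : S}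
    (h : le d c) (hc : c ∈ disj cov le B) : d ∈ disj cov le B := by
  rintro e ⟨_, rfl, b, hb, h₁, h₂⟩
  exact hc e ⟨c, rfl, b, hb, hft.2.2.1 h₁ h, h₂⟩

theorem cov_disj_union_of_forall_wc (hft : IsFormalTopology cov le) {C : Set S} (F : Finset S)
    (h : ∀ y ∈ F, ∃ c ∈ C, wc cov le y c) (z : S) : cov z (disj cov le ↑F ∪ C) := by
  obtain ⟨hb, _, _, hle, hdn⟩ := id hft
  induction F using Finset.induction_on with
  | empty => exact hb.1 _ _ (Or.inl (by rintro e ⟨_, _, b, hb, _⟩; simp at hb))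
  | insert y F _ ih =>
    obtain ⟨c, hc, hyc⟩ := h y (Finset.mem_insert_self _ _)
    have ih := ih fun z hz => h z (Finset.mem_insert_of_mem hz)
    refine hb.2 _ _ _ (hdn _ _ _ (hyc z trivial) ih) ?_
    have hC : ∀ x ∈ C, ∀ d, le d x → cov d (disj cov le ↑(insert y F) ∪ C) := fun x hx d hd =>
      hb.mono (hle _ _ hd) (by rintro _ rfl; exact Or.inr hx)
    rintro d ⟨u, hu, v, hv, hdu, hdv⟩
    rcases hu with hu | rfl
    · rcases hv with hv | hv
      · refine hb.1 _ _ (Or.inl ?_)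
        rintro e ⟨_, rfl, x, hx, he, hex⟩
        rcases Finset.mem_insert.1 (Finset.mem_coe.1 hx) with rfl | hx
        · exact hft.disj_of_le (B := {x}) hdu hu e ⟨_, rfl, x, rfl, he, hex⟩
        · exact hft.disj_of_le hdv hv e ⟨_, rfl, x, hx, he, hex⟩
      · exact hC v hv d hdv
    · exact hC u hc d hdu

/-- In a regular formal topology, `B ≪ C` implies `B ⋘ C`. -/
theorem Regular.cov_disj_union (hft : IsFormalTopology cov le) (hreg : Regular cov le)
    {B C : Set S} (h : wbS cov B C) (z : S) : cov z (disj cov le B ∪ C) := by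
  have hb := hft.1
  obtain ⟨F, hF, hBF⟩ := h {y | ∃ c ∈ C, wc cov le y c} fun c hc =>
    hb.mono (hreg c) fun y hy => ⟨c, hc, hy⟩
  exact hb.mono (cov_disj_union_of_forall_wc hft F (fun y hy => hF hy) z)
    (Set.union_subset_union_left _ (hft.disj_anti hBF))

/-- The elements disjoint from some finite `B'` with `B ≪ B'`. -/
def exterior (cov : S → Set S → Prop) (le : S → S → Prop) (B : Set S) : Set S :=
  {c | ∃ B' : Finset S, wbS cov B ↑B' ∧ c ∈ disj cov le ↑B'}

end FormalTopology

section GCov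

variable {P : Type*} {T : Finset P → Set (Finset P) → Prop}

theorem GCov.of_ax {A : Finset P} {𝒞 : Set (Finset P)} (h : T A 𝒞) : GCov T A 𝒞 := by
  have := GCov.ax (𝒰 := 𝒞) ∅ h fun B hB => GCov.refl (by simpa using hB)
  simpa using this

theorem GCov.union_left {A : Finset P} {𝒞 𝒰 : Set (Finset P)} (h : GCov T A 𝒞) :
    ∀ D : Finset P, (∀ B ∈ 𝒞, GCov T (D ∪ B) 𝒰) → GCov T (D ∪ A) 𝒰 := by
  induction h with
  | refl hA => exact fun D hD => hD _ hA
  | le hBA _ ih => exact fun D hD => GCov.le (Finset.union_subset_union_right hBA) (ih D hD)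
  | ax C hT _ ih =>
    intro D hD
    rw [← Finset.union_assoc]
    refine GCov.ax _ hT fun B hB => ?_
    rw [Finset.union_assoc]
    exact ih B hB D hD

theorem GCov.cut {A : Finset P} {𝒞 𝒰 : Set (Finset P)} (h : GCov T A 𝒞)
    (h' : ∀ B ∈ 𝒞, GCov T (A ∪ B) 𝒰) : GCov T A 𝒰 := by
  simpa using h.union_left A h'

theorem GCov.cut_ax {A B : Finset P} {𝒞 𝒰 : Set (Finset P)} (h : T B 𝒞) (hBA : B ⊆ A)
    (h' : ∀ C ∈ 𝒞, GCov T (A ∪ C) 𝒰) : GCov T A 𝒰 :=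
  GCov.cut (GCov.le hBA (GCov.of_ax h)) h'

theorem GCov.of_subset_mem {A B : Finset P} {𝒰 : Set (Finset P)} (hBA : B ⊆ A) (hB : B ∈ 𝒰) :
    GCov T A 𝒰 :=
  GCov.le hBA (GCov.refl hB)

theorem GCov.singleton_of_forall {A B : Finset P} (h : ∀ g ∈ B, GCov T A {{g}}) :
    GCov T A {B} := by
  induction B using Finset.induction_on with
  | empty => exact GCov.of_subset_mem (Finset.empty_subset _) rfl
  | insert g B _ ih =>
    refine GCov.cut (h g (Finset.mem_insert_self _ _)) ?_
    rintro _ rfl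
    refine GCov.cut (GCov.le Finset.subset_union_left
      (ih fun x hx => h x (Finset.mem_insert_of_mem hx))) ?_
    rintro _ rfl
    refine GCov.of_subset_mem ?_ (Set.mem_singleton _)
    intro x
    simp only [Finset.mem_insert, Finset.mem_union, Finset.mem_singleton]
    tauto

end GCov

section Patch

variable {S : Type*} {cov : S → Set S → Prop} {le : S → S → Prop}

theorem patchCov_r {a : S} {U : Set S} (h : cov a U) :
    patchCov cov le {PatchGen.r a} {B | ∃ b ∈ U, B = {PatchGen.r b}} := by
  refine GCov_trans (GCov.of_ax (PatchThy.R4 a)) ?_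
  rintro _ ⟨b, hba, rfl⟩
  obtain ⟨U₀, hU, hbU⟩ := hba U h
  refine GCov_trans (GCov.of_ax (PatchThy.R3 b U₀ hbU)) ?_
  rintro _ ⟨c, hc, rfl⟩
  exact GCov.refl ⟨c, hU hc, rfl⟩

theorem patchCov_inf {𝔄 : Finset (PatchGen S)} {a b : S}
    (ha : patchCov cov le 𝔄 {{PatchGen.r a}}) (hb : patchCov cov le 𝔄 {{PatchGen.r b}}) :
    patchCov cov le 𝔄 {B | ∃ c ∈ down le {a} {b}, B = {PatchGen.r c}} := by
  refine GCov_trans (GCov.singleton_of_forall (B := {PatchGen.r a, PatchGen.r b}) ?_) ?_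
  · intro g hg
    rcases Finset.mem_insert.1 hg with rfl | hg
    · exact ha
    · rw [Finset.mem_singleton.1 hg]; exact hb
  · rintro _ rfl
    exact GCov.of_ax (PatchThy.R2 a b)

theorem patchCov_l_or_r_of_forall_wb (hb : IsBasicCover cov) {C : Set S} (F : Finset S)
    (h : ∀ y ∈ F, ∃ c ∈ C, wb cov y c) :
    patchCov cov le ∅ ({{PatchGen.l F}} ∪ {B | ∃ c ∈ C, B = {PatchGen.r c}}) := by
  induction F using Finset.induction_on with
  | empty => exact GCov_trans (GCov.of_ax PatchThy.L1) fun B hB => GCov.refl (Or.inl hB)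
  | insert y F _ ih =>
    obtain ⟨c, hc, hyc⟩ := h y (Finset.mem_insert_self _ _)
    refine GCov_trans (ih fun z hz => h z (Finset.mem_insert_of_mem hz)) ?_
    rintro _ (rfl | hB)
    · refine GCov.cut_ax (PatchThy.Loc y c hyc) (Finset.empty_subset _) ?_
      rintro _ (rfl | rfl)
      · refine GCov.cut_ax (PatchThy.L3 {y} F) (fun x => by simp; tauto) ?_
        rintro _ ⟨D, hyD, hFD, rfl⟩
        refine GCov.cut_ax (PatchThy.L2 (insert y F) D ?_) Finset.subset_union_right ?_
        · rw [Finset.insert_eq]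
          exact (wbS_union hb hyD hFD).covS hb
        · rintro _ rfl
          exact GCov.of_subset_mem Finset.subset_union_right (Or.inl rfl)
      · exact GCov.of_subset_mem Finset.subset_union_right (Or.inr ⟨c, hc, rfl⟩)
    · exact GCov.refl (Or.inr hB)

theorem patchCov_l_or_r (hb : IsBasicCover cov) {w : S → Set S} (hw : IsContinuous cov w)
    {B : Finset S} {C : Set S} (h : wbS cov ↑B C) :
    patchCov cov le ∅ ({{PatchGen.l B}} ∪ {X | ∃ c ∈ C, X = {PatchGen.r c}}) := by
  obtain ⟨F, hF, hFC⟩ := hw.exists_finset_wb hb h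
  refine GCov_trans (patchCov_l_or_r_of_forall_wb hb F hFC) ?_
  rintro _ (rfl | hX)
  · exact GCov_trans (GCov.of_ax (PatchThy.L2 B F hF)) fun X hX => GCov.refl (Or.inl hX)
  · exact GCov.refl (Or.inr hX)

theorem patchCov_l_of_exterior (hb : IsBasicCover cov) {w : S → Set S} (hw : IsContinuous cov w)
    {B : Finset S} {c : S} (h : c ∈ exterior cov le ↑B) :
    patchCov cov le {PatchGen.r c} {{PatchGen.l B}} := by
  obtain ⟨B', hBB', hc⟩ := h
  refine GCov.cut (GCov.le (Finset.empty_subset _) (patchCov_l_or_r hb hw hBB')) ?_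
  rintro _ (rfl | ⟨b, hbB, rfl⟩)
  · exact GCov.of_subset_mem Finset.subset_union_right rfl
  · refine GCov.cut_ax (PatchThy.R2 c b) (Finset.Subset.refl _) ?_
    rintro _ ⟨d, ⟨_, rfl, _, rfl, h₁, h₂⟩, rfl⟩
    refine GCov.cut_ax (PatchThy.R3 d ∅ ?_) Finset.subset_union_right (by simp)
    simpa using hc d ⟨_, rfl, _, hbB, h₁, h₂⟩

theorem patchCov_r_exterior (hft : IsFormalTopology cov le) {w : S → Set S}
    (hw : IsContinuous cov w) (hreg : Regular cov le) (B : Finset S) :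
    patchCov cov le {PatchGen.l B} {X | ∃ c ∈ exterior cov le ↑B, X = {PatchGen.r c}} := by
  have hb := hft.1
  refine GCov.cut_ax (PatchThy.L3 B B) (by simp) ?_
  rintro _ ⟨C, hBC, _, rfl⟩
  obtain ⟨B', hBB', hB'C⟩ := hw.exists_between hb hBC
  refine GCov.cut_ax PatchThy.R1 (Finset.empty_subset _) ?_
  rintro _ ⟨a, rfl⟩
  refine GCov.cut (GCov.le Finset.subset_union_right
    (patchCov_r (hreg.cov_disj_union hft hB'C a))) ?_
  rintro _ ⟨c, hc | hc, rfl⟩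
  · exact GCov.of_subset_mem Finset.subset_union_right ⟨c, ⟨B', hBB', hc⟩, rfl⟩
  · refine GCov.cut_ax (PatchThy.L2 {c} C ?_) (fun x => by simp; tauto) ?_
    · intro x hx
      exact hb.1 _ _ (by simp at hx; exact hx ▸ hc)
    · rintro _ rfl
      exact GCov.cut_ax (PatchThy.D c) (fun x => by simp; tauto) (by simp)

theorem isFTM_epsP :
    IsFTM (patchCov cov le) supord cov le (epsP cov le) := by
  refine ⟨?_, ?_, ?_⟩
  · rintro a U haU 𝔄 ⟨_, rfl, h⟩
    refine GCov_trans h ?_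
    rintro _ rfl
    refine GCov_trans (patchCov_r haU) ?_
    rintro _ ⟨b, hb, rfl⟩
    exact GCov.refl ⟨b, hb, GCov.refl rfl⟩
  · intro 𝔄 _
    refine GCov.cut_ax PatchThy.R1 (Finset.empty_subset _) ?_
    rintro _ ⟨a, rfl⟩
    exact GCov.of_subset_mem Finset.subset_union_right ⟨a, trivial, GCov.refl rfl⟩
  · rintro a b ℭ ⟨𝔄, ⟨_, rfl, ha⟩, 𝔅, ⟨_, rfl, hb⟩, h₁, h₂⟩
    refine GCov_trans (patchCov_inf (GCov.le h₁ ha) (GCov.le h₂ hb)) ?_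
    rintro _ ⟨c, hc, rfl⟩
    exact GCov.refl ⟨c, hc, GCov.refl rfl⟩

/-- The inverse of `epsP` on generators. -/
def epsInvGen (cov : S → Set S → Prop) (le : S → S → Prop) (x : S) : PatchGen S → Prop
  | PatchGen.r b => cov x {b}
  | PatchGen.l B => cov x (exterior cov le ↑B)

/-- The inverse of `epsP`. -/
def epsInv (cov : S → Set S → Prop) (le : S → S → Prop) (x : S) (𝔅 : Finset (PatchGen S)) :
    Prop :=
  ∀ g ∈ 𝔅, epsInvGen cov le x g

theorem epsInvGen.of_le (hft : IsFormalTopology cov le) {x y : S} (hyx : le y x) {g : PatchGen S}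
    (h : epsInvGen cov le x g) : epsInvGen cov le y g := by
  have key : ∀ U, cov x U → cov y U := fun U hU =>
    hft.1.2 _ _ _ (hft.2.2.2.1 _ _ hyx) (by rintro _ rfl; exact hU)
  cases g <;> exact key _ h

theorem epsInv.of_le (hft : IsFormalTopology cov le) {x y : S} (hyx : le y x)
    {𝔅 : Finset (PatchGen S)} (h : epsInv cov le x 𝔅) : epsInv cov le y 𝔅 :=
  fun g hg => (h g hg).of_le hft hyx

@[simp] theorem epsInv_empty (x : S) : epsInv cov le x ∅ := by simp [epsInv]

@[simp] theorem epsInv_singleton (x : S) (g : PatchGen S) :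
    epsInv cov le x {g} ↔ epsInvGen cov le x g := by simp [epsInv]

@[simp] theorem epsInv_pair (x : S) (g g' : PatchGen S) :
    epsInv cov le x {g, g'} ↔ epsInvGen cov le x g ∧ epsInvGen cov le x g' := by simp [epsInv]

theorem epsInv_union {x : S} {𝔄 𝔅 : Finset (PatchGen S)} (hA : epsInv cov le x 𝔄)
    (hB : epsInv cov le x 𝔅) : epsInv cov le x (𝔄 ∪ 𝔅) :=
  fun g hg => (Finset.mem_union.1 hg).elim (hA g) (hB g)

theorem epsInv_sound (hft : IsFormalTopology cov le) {w : S → Set S}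
    (hw : IsContinuous cov w) (hreg : Regular cov le) {𝔄 : Finset (PatchGen S)}
    {𝒞 : Set (Finset (PatchGen S))} (hT : PatchThy cov le 𝔄 𝒞) {x : S}
    (hx : epsInv cov le x 𝔄) : cov x (rinv (epsInv cov le) 𝒞) := by
  obtain ⟨hb, -, -, hle, hdn⟩ := id hft
  have hr : ∀ b, epsInvGen cov le b (PatchGen.r b) := fun b => hb.1 _ _ rfl
  cases hT with
  | R1 => exact hb.1 _ _ ⟨_, ⟨x, rfl⟩, by simpa using hr x⟩
  | R2 a b =>
    rw [epsInv_pair] at hx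
    exact hb.mono (hdn _ _ _ hx.1 hx.2) fun c hc => ⟨_, ⟨c, hc, rfl⟩, by simpa using hr c⟩
  | R3 a A h =>
    rw [epsInv_singleton] at hx
    refine hb.2 _ _ _ hx ?_
    rintro _ rfl
    exact hb.mono h fun b hbA => ⟨_, ⟨b, hbA, rfl⟩, by simpa using hr b⟩
  | R4 a =>
    rw [epsInv_singleton] at hx
    refine hb.2 _ _ _ hx ?_
    rintro _ rfl
    exact hb.mono (hw.2 _) fun b hba => ⟨_, ⟨b, hw.1 _ b hba, rfl⟩, by simpa using hr b⟩
  | L1 =>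
    refine hb.1 _ _ ⟨_, rfl, (epsInv_singleton _ _).2 (hb.1 _ _ ⟨∅, ?_, ?_⟩)⟩
    · exact fun W _ => ⟨∅, by simp, by simp [covS]⟩
    · rintro e ⟨_, _, b, hb, _⟩
      simp at hb
  | L2 A B h =>
    rw [epsInv_singleton] at hx
    refine hb.1 _ _ ⟨_, rfl, (epsInv_singleton _ _).2 (hb.mono hx ?_)⟩
    rintro c ⟨B', hB', hc⟩
    exact ⟨B', wbS_of_covS_left hb h hB', hc⟩
  | L3 A B =>
    rw [epsInv_pair] at hx
    refine hb.2 _ _ _ (hdn _ _ _ hx.1 hx.2) ?_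
    rintro c ⟨u, ⟨A', hA', hu⟩, v, ⟨B', hB', hv⟩, hcu, hcv⟩
    obtain ⟨A'', hA₁, hA₂⟩ := hw.exists_between hb hA'
    obtain ⟨B'', hB₁, hB₂⟩ := hw.exists_between hb hB'
    have hsub : ∀ {X Y : Finset S}, X ⊆ Y → covS cov ↑X ↑Y := fun h y hy =>
      hb.1 _ _ (h (Finset.mem_coe.1 hy))
    refine hb.1 _ _ ⟨_, ⟨A'' ∪ B'', wbS_of_covS_right hb hA₁ (hsub Finset.subset_union_left),
      wbS_of_covS_right hb hB₁ (hsub Finset.subset_union_right), rfl⟩,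
      (epsInv_singleton _ _).2 (hb.1 _ _ ⟨A' ∪ B', wbS_union hb
        (wbS_of_covS_right hb hA₂ (hsub Finset.subset_union_left))
        (wbS_of_covS_right hb hB₂ (hsub Finset.subset_union_right)), ?_⟩)⟩
    rintro e ⟨_, rfl, y, hy, he, hey⟩
    rcases Finset.mem_union.1 (Finset.mem_coe.1 hy) with hy | hy
    · exact hft.disj_of_le hcu hu e ⟨_, rfl, y, hy, he, hey⟩
    · exact hft.disj_of_le hcv hv e ⟨_, rfl, y, hy, he, hey⟩
  | Loc a b h =>
    obtain ⟨X, hX₁, hX₂⟩ := hw.exists_between hb (wbS_singleton h)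
    refine hb.mono (hreg.cov_disj_union hft hX₂ x) ?_
    rintro c (hc | rfl)
    · exact ⟨_, Or.inl rfl, (epsInv_singleton _ _).2 (hb.1 _ _ ⟨X, by simpa using hX₁, hc⟩)⟩
    · exact ⟨_, Or.inr rfl, by simpa using hr c⟩
  | D a =>
    rw [epsInv_pair] at hx
    refine hb.2 _ _ _ (hdn _ _ _ hx.1 hx.2) ?_
    rintro c ⟨u, ⟨A', hA', hu⟩, _, rfl, hcu, hca⟩
    refine hb.2 c ∅ _ (hft.disj_anti (hA'.covS hb) hu c ⟨_, rfl, _, by simp, hcu, hca⟩) ?_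
    simp [covS]

theorem epsInv_cov (hft : IsFormalTopology cov le) {w : S → Set S}
    (hw : IsContinuous cov w) (hreg : Regular cov le) {𝔄 : Finset (PatchGen S)}
    {𝒰 : Set (Finset (PatchGen S))} (h : patchCov cov le 𝔄 𝒰) :
    ∀ {x : S}, epsInv cov le x 𝔄 → cov x (rinv (epsInv cov le) 𝒰) := by
  obtain ⟨hb, hrefl, -, hle, hdn⟩ := id hft
  induction h with
  | refl hA => exact fun hx => hb.1 _ _ ⟨_, hA, hx⟩
  | le hBA _ ih => exact fun hx => ih fun g hg => hx g (hBA hg)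
  | ax C hT _ ih =>
    intro x hx
    have hC : epsInv cov le x C := fun g hg => hx g (Finset.mem_union_left _ hg)
    have hA := epsInv_sound hft hw hreg hT fun g hg => hx g (Finset.mem_union_right _ hg)
    refine hb.2 _ _ _ (hdn x {x} _ (hb.1 _ _ rfl) hA) ?_
    rintro y ⟨_, rfl, z, ⟨B, hB, hz⟩, hyx, hyz⟩
    exact ih B hB (epsInv_union (hC.of_le hft hyx) (hz.of_le hft hyz))

theorem isFTM_epsInv (hft : IsFormalTopology cov le) {w : S → Set S}
    (hw : IsContinuous cov w) (hreg : Regular cov le) :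
    IsFTM cov le (patchCov cov le) supord (epsInv cov le) := by
  refine ⟨?_, ?_, ?_⟩
  · rintro 𝔄 𝒰 h x ⟨_, rfl, hx⟩
    exact epsInv_cov hft hw hreg h hx
  · exact fun x _ => hft.1.1 _ _ ⟨∅, trivial, epsInv_empty x⟩
  · rintro 𝔄 𝔅 x ⟨a, ⟨_, rfl, ha⟩, b, ⟨_, rfl, hb⟩, hxa, hxb⟩
    exact hft.1.1 _ _ ⟨_ ∪ _, ⟨_, rfl, _, rfl, Finset.subset_union_left,
      Finset.subset_union_right⟩, epsInv_union (ha.of_le hft hxa) (hb.of_le hft hxb)⟩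

theorem patchCov_singleton_of_epsInv (hb : IsBasicCover cov) {w : S → Set S}
    (hw : IsContinuous cov w) {a : S} {𝔅 : Finset (PatchGen S)} (h : epsInv cov le a 𝔅) :
    patchCov cov le {PatchGen.r a} {𝔅} := by
  refine GCov.singleton_of_forall fun g hg => ?_
  have hg := h g hg
  cases g with
  | r b =>
    refine GCov_trans (patchCov_r hg) ?_
    rintro _ ⟨_, rfl, rfl⟩
    exact GCov.refl rfl
  | l B =>
    refine GCov_trans (patchCov_r hg) ?_
    rintro _ ⟨c, hc, rfl⟩
    exact patchCov_l_of_exterior hb hw hc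

theorem patchCov_r_epsInv (hft : IsFormalTopology cov le) {w : S → Set S}
    (hw : IsContinuous cov w) (hreg : Regular cov le) (𝔅 : Finset (PatchGen S)) :
    patchCov cov le 𝔅 {X | ∃ a, epsInv cov le a 𝔅 ∧ X = {PatchGen.r a}} := by
  have hb := hft.1
  induction 𝔅 using Finset.induction_on with
  | empty =>
    refine GCov_trans (GCov.of_ax PatchThy.R1) ?_
    rintro _ ⟨a, rfl⟩
    exact GCov.refl ⟨a, epsInv_empty a, rfl⟩
  | insert g 𝔅 _ ih =>
    have hg : patchCov cov le {g} {X | ∃ a, epsInvGen cov le a g ∧ X = {PatchGen.r a}} := by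
      cases g with
      | r b => exact GCov.refl ⟨b, hb.1 _ _ rfl, rfl⟩
      | l B =>
        refine GCov_trans (patchCov_r_exterior hft hw hreg B) ?_
        rintro _ ⟨c, hc, rfl⟩
        exact GCov.refl ⟨c, hb.1 _ _ hc, rfl⟩
    refine GCov.cut (GCov.le (Finset.subset_insert _ _) ih) ?_
    rintro _ ⟨a, ha, rfl⟩
    refine GCov.cut (GCov.le (by simp) hg) ?_
    rintro _ ⟨b, hbg, rfl⟩
    refine GCov_trans (patchCov_inf (a := a) (b := b)
      (GCov.of_subset_mem (B := {PatchGen.r a}) (by simp) rfl)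
      (GCov.of_subset_mem (B := {PatchGen.r b}) (by simp) rfl)) ?_
    rintro _ ⟨c, ⟨_, rfl, _, rfl, hca, hcb⟩, rfl⟩
    refine GCov.refl ⟨c, fun x hx => ?_, rfl⟩
    rcases Finset.mem_insert.1 hx with rfl | hx
    · exact hbg.of_le hft hcb
    · exact (ha x hx).of_le hft hca

end Patch

/-- If `S` is a locally compact regular formal topology, then
`ε_P : Patch(S) → S` is an isomorphism of formal topologies. -/
theorem epsP_iso_of_locally_compact_regular {S : Type u}
    (cov : S → Set S → Prop) (le : S → S → Prop)
    (hft : IsFormalTopology cov le) (w : S → Set S) (hw : IsContinuous cov w)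
    (hreg : Regular cov le) :
    IsFTM (patchCov cov le) supord cov le (epsP cov le) ∧
    ∃ s : S → Finset (PatchGen S) → Prop,
      IsFTM cov le (patchCov cov le) supord s ∧
      MapEq cov (comp (epsP cov le) s) (fun a b => a = b) ∧
      MapEq (patchCov cov le) (comp s (epsP cov le)) (fun A B => A = B) := by
  have hb := hft.1
  refine ⟨isFTM_epsP, epsInv cov le, isFTM_epsInv hft hw hreg, ⟨?_, ?_⟩, ?_, ?_⟩
  · rintro a x ⟨_, rfl, 𝔅, hx, h⟩
    refine hb.2 _ _ _ (epsInv_cov hft hw hreg h hx) ?_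
    rintro y ⟨_, rfl, hy⟩
    exact hb.mono ((epsInv_singleton _ _).1 hy) (by rintro _ rfl; exact ⟨_, rfl, rfl⟩)
  · rintro a x ⟨_, rfl, rfl⟩
    exact hb.1 _ _ ⟨x, rfl, {PatchGen.r x}, (epsInv_singleton _ _).2 (hb.1 _ _ rfl), GCov.refl rfl⟩
  · rintro 𝔅 𝔄 ⟨_, rfl, a, h, ha⟩
    refine GCov_trans h ?_
    rintro _ rfl
    refine GCov_trans (patchCov_singleton_of_epsInv hb hw ha) ?_
    rintro _ rfl
    exact GCov.refl ⟨_, rfl, rfl⟩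
  · rintro 𝔅 𝔄 ⟨_, rfl, rfl⟩
    refine GCov_trans (patchCov_r_epsInv hft hw hreg 𝔄) ?_
    rintro _ ⟨a, ha, rfl⟩
    exact GCov.refl ⟨𝔄, rfl, a, GCov.refl rfl, ha⟩

end FTP
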